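/- (At most N independent linear relations) Let ρ be a stationary distribution of the Markov chain T, and let 𝒯 = (𝒯_1,…,𝒯_N) be the matrix collecting the strategy vectors of all players. Then dim( span(𝒯) ∩ span(𝒮) ) ≤ N. In particular, for any subset N' of players, dim span(⋃_{n∈N'} V_n) ≤ N: any set of ZD strategies enforces at most N independent linear relations on the expected payoffs. -/

import Mathlib

theorem marg_aux {N : ℕ} {M : Fin N → ℕ} (f : ∀ m, Fin (M m) → ℝ)
    (hf : ∀ m, ∑ a, f m a = 1) (n : Fin N) (b : ∀ m, Fin (M m)) :
    ∑ σ : ∀ m, Fin (M m), (if b n = σ n then (1 : ℝ) else 0) * ∏ m, f m (σ m) = f n (b n) := by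
  classical
  let g : ∀ m, Fin (M m) → ℝ := fun m x => if m = n ∧ b m ≠ x then 0 else f m x
  have h1 : ∀ σ : ∀ m, Fin (M m),
      (if b n = σ n then (1 : ℝ) else 0) * ∏ m, f m (σ m) = ∏ m, g m (σ m) := by
    intro σ
    by_cases h : b n = σ n
    · rw [if_pos h, one_mul]
      refine Finset.prod_congr rfl fun m _ => ?_
      have : ¬ (m = n ∧ b m ≠ σ m) := by
        rintro ⟨rfl, h'⟩
        exact h' h
      simp only [g, if_neg this]
    · rw [if_neg h, zero_mul]
      symm
      apply Finset.prod_eq_zero (Finset.mem_univ n)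
      simp [g, h]
  rw [Finset.sum_congr rfl fun σ _ => h1 σ]
  have h2 := Finset.prod_univ_sum (fun m => (Finset.univ : Finset (Fin (M m)))) g
  rw [Fintype.piFinset_univ] at h2
  rw [← h2, Finset.prod_eq_single n]
  · rw [Finset.sum_eq_single (b n)]
    · simp [g]
    · intro x _ hx
      simp [g, Ne.symm hx]
    · simp
  · intro m _ hm
    simp [g, hm, hf]
  · simp

/-- At most `N` independent linear relations: `dim(span 𝒯 ∩ span 𝒮) ≤ N`,
and in particular, for any subset `N'` of players,
`dim span(⋃_{n∈N'} V_n) ≤ N`. -/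
theorem at_most_N_independent_relations
    (N : ℕ) (hN : 1 ≤ N) (M : Fin N → ℕ) (hM : ∀ n, 1 ≤ M n)
    (B : Type) [Fintype B]
    (W : B → (∀ m, Fin (M m)) → ℝ)
    (hW0 : ∀ τ σ', 0 ≤ W τ σ')
    (hW1 : ∀ σ', ∑ τ, W τ σ' = 1)
    (That : (n : Fin N) → Fin (M n) → Fin (M n) → B → ℝ)
    (hThat0 : ∀ n a a' τ, 0 ≤ That n a a' τ)
    (hThat1 : ∀ n (a' : Fin (M n)) (τ : B), ∑ a, That n a a' τ = 1)
    (s : Fin N → (∀ m, Fin (M m)) → ℝ)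
    (ρ : (∀ m, Fin (M m)) → ℝ)
    (hρ0 : ∀ σ, 0 ≤ ρ σ)
    (hρ1 : ∑ σ, ρ σ = 1)
    (hρstat : ∀ σ, ρ σ =
      ∑ σ', (∑ τ, W τ σ' * ∏ m, That m (σ m) (σ' m) τ) * ρ σ')
    (spanT : Fin N → Submodule ℝ ((∀ m, Fin (M m)) → ℝ))
    (hspanT : ∀ n, spanT n = Submodule.span ℝ (Set.range fun a : Fin (M n) =>
      fun σ' : ∀ m, Fin (M m) =>
        (∑ τ, W τ σ' * That n a (σ' n) τ) - (if a = σ' n then 1 else 0)))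
    -- span of the full collection 𝒯 = (𝒯_1, …, 𝒯_N) of strategy vectors
    (spanTall : Submodule ℝ ((∀ m, Fin (M m)) → ℝ))
    (hspanTall : spanTall = Submodule.span ℝ {v : (∀ m, Fin (M m)) → ℝ |
      ∃ (n : Fin N) (a : Fin (M n)), v = fun σ' =>
        (∑ τ, W τ σ' * That n a (σ' n) τ) - (if a = σ' n then 1 else 0)})
    (spanS : Submodule ℝ ((∀ m, Fin (M m)) → ℝ))
    (hspanS : spanS = Submodule.span ℝ
      (Set.range (Fin.cons (fun _ => (1 : ℝ)) s :
        Fin (N + 1) → (∀ m, Fin (M m)) → ℝ))) :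
    Module.finrank ℝ ↥(spanTall ⊓ spanS) ≤ N ∧
    ∀ N' : Set (Fin N),
      Module.finrank ℝ ↥(⨆ n ∈ N', spanT n ⊓ spanS) ≤ N := by
  let φ : ((∀ m, Fin (M m)) → ℝ) →ₗ[ℝ] ℝ :=
    { toFun := fun v => ∑ σ, v σ * ρ σ
      map_add' := by intro x y; simp [add_mul, Finset.sum_add_distrib]
      map_smul' := by intro c x; simp [mul_assoc, Finset.mul_sum] }
  have hφ : ∀ v, φ v = ∑ σ, v σ * ρ σ := fun v => rfl
  have key : ∀ (n : Fin N) (a : Fin (M n)), φ (fun σ' =>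
      (∑ τ, W τ σ' * That n a (σ' n) τ) - (if a = σ' n then 1 else 0)) = 0 := by
    intro n a
    let b : ∀ m, Fin (M m) := Function.update (fun m => ⟨0, hM m⟩) n a
    have hb : b n = a := by simp [b]
    rw [hφ]
    simp only [sub_mul, Finset.sum_sub_distrib]
    rw [sub_eq_zero]
    symm
    calc ∑ σ : ∀ m, Fin (M m), (if a = σ n then (1 : ℝ) else 0) * ρ σ
        = ∑ σ : ∀ m, Fin (M m), ∑ σ' : ∀ m, Fin (M m), ∑ τ, (W τ σ' * ρ σ') *
            ((if b n = σ n then (1 : ℝ) else 0) * ∏ m, That m (σ m) (σ' m) τ) := by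
          refine Finset.sum_congr rfl fun σ _ => ?_
          rw [hρstat σ, Finset.mul_sum, hb]
          refine Finset.sum_congr rfl fun σ' _ => ?_
          rw [Finset.sum_mul, Finset.mul_sum]
          refine Finset.sum_congr rfl fun τ _ => ?_
          ring
      _ = ∑ σ' : ∀ m, Fin (M m), ∑ τ, ∑ σ : ∀ m, Fin (M m), (W τ σ' * ρ σ') *
            ((if b n = σ n then (1 : ℝ) else 0) * ∏ m, That m (σ m) (σ' m) τ) := by
          rw [Finset.sum_comm]
          exact Finset.sum_congr rfl fun σ' _ => Finset.sum_comm
      _ = _ := by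
          refine Finset.sum_congr rfl fun σ' _ => ?_
          rw [Finset.sum_mul]
          refine Finset.sum_congr rfl fun τ _ => ?_
          rw [← Finset.mul_sum, marg_aux (fun m x => That m x (σ' m) τ)
            (fun m => hThat1 m (σ' m) τ) n b, hb]
          ring
  have hker : spanTall ≤ LinearMap.ker φ := by
    rw [hspanTall, Submodule.span_le]
    rintro v ⟨n, a, rfl⟩
    exact key n a
  have hone : (fun _ => (1 : ℝ)) ∈ spanS := by
    rw [hspanS]
    exact Submodule.subset_span ⟨0, rfl⟩
  have hlt : spanTall ⊓ spanS < spanS := by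
    refine lt_of_le_of_ne inf_le_right fun h => ?_
    rw [← h] at hone
    have h0 : φ (fun _ => (1 : ℝ)) = 0 := hker hone.1
    rw [hφ] at h0
    simp [hρ1] at h0
  have hS : Module.finrank ℝ spanS ≤ N + 1 := by
    rw [hspanS]
    refine (finrank_range_le_card _).trans ?_
    simp
  have h1 : Module.finrank ℝ ↥(spanTall ⊓ spanS) ≤ N := by
    have := Submodule.finrank_lt_finrank_of_lt hlt
    omega
  refine ⟨h1, fun N' => le_trans (Submodule.finrank_mono ?_) h1⟩
  refine iSup₂_le fun n _ => inf_le_inf_right _ ?_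
  rw [hspanT, hspanTall]
  apply Submodule.span_mono
  rintro v ⟨a, rfl⟩
  exact ⟨n, a, rfl⟩
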